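/- arXiv:1809.04565 — 4 statements merged into one kernel-verified Lean document; each statement's English description precedes it below -/
import Mathlib

section
/- (Theorem 1) Fix reals g and b (the branch conductance and susceptance) and take α_c = −g and α_s = −b, so that φ(x₁,x₂,x₃,x₄) = −g x₁x₂x₃ − b x₁x₂x₄ is the non-convex term of the active power flow p = g v_i² − g v_i v_j ĉs − b v_i v_j ŝn (with x₁ = v_i, x₂ = v_j the voltage magnitudes, x₃ the lifted cosine variable, x₄ the lifted sine variable). If l₁ < u₁ and l₂ < u₂, then the strengthened (TLM) relaxation set S_QC equals the convex hull of the graph of this term over the box: S_QC = convexHull ℝ {(−g x₁x₂x₃ − b x₁x₂x₄, x₁, x₂, x₃, x₄) : (x₁,x₂,x₃,x₄) ∈ B}. -/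
open Finset Real

noncomputable section

/-- Vertices of the box `[l1,u1] × [l2,u2] × [l3,u3]` in lexicographic order. -/
def xiC (l1 u1 l2 u2 l3 u3 : ℝ) : Fin 8 → ℝ × ℝ × ℝ :=
  ![(l1, l2, l3), (l1, l2, u3), (l1, u2, l3), (l1, u2, u3),
    (u1, l2, l3), (u1, l2, u3), (u1, u2, l3), (u1, u2, u3)]

/-- The trilinear product of the coordinates of a point of `ℝ³`. -/
def tri (p : ℝ × ℝ × ℝ) : ℝ := p.1 * p.2.1 * p.2.2

/-- The linking constraint between the multipliers `lc` and `ls`. -/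
def Linking (l1 u1 l2 u2 : ℝ) (lc ls : Fin 8 → ℝ) : Prop :=
    (lc 0 + lc 1 - ls 0 - ls 1) * (l1 * l2)
  + (lc 2 + lc 3 - ls 2 - ls 3) * (l1 * u2)
  + (lc 4 + lc 5 - ls 4 - ls 5) * (u1 * l2)
  + (lc 6 + lc 7 - ls 6 - ls 7) * (u1 * u2) = 0

/-- The sum of two trilinear terms sharing the first two variables. -/
def phi (ac as : ℝ) (x : ℝ × ℝ × ℝ × ℝ) : ℝ :=
  ac * (x.1 * x.2.1 * x.2.2.1) + as * (x.1 * x.2.1 * x.2.2.2)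

/-- The box `B = [l1,u1] × [l2,u2] × [l3,u3] × [l4,u4] ⊆ ℝ⁴`. -/
def boxB (l1 u1 l2 u2 l3 u3 l4 u4 : ℝ) : Set (ℝ × ℝ × ℝ × ℝ) :=
  {x | x.1 ∈ Set.Icc l1 u1 ∧ x.2.1 ∈ Set.Icc l2 u2 ∧
       x.2.2.1 ∈ Set.Icc l3 u3 ∧ x.2.2.2 ∈ Set.Icc l4 u4}

/-- The set of vertices of the box `B`. -/
def vertB (l1 u1 l2 u2 l3 u3 l4 u4 : ℝ) : Set (ℝ × ℝ × ℝ × ℝ) :=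
  {x | (x.1 = l1 ∨ x.1 = u1) ∧ (x.2.1 = l2 ∨ x.2.1 = u2) ∧
       (x.2.2.1 = l3 ∨ x.2.2.1 = u3) ∧ (x.2.2.2 = l4 ∨ x.2.2.2 = u4)}

/-- The strengthened (TLM) relaxation set `S_QC ⊆ ℝ⁵`. -/
def SQC (l1 u1 l2 u2 l3 u3 l4 u4 ac as : ℝ) : Set (ℝ × ℝ × ℝ × ℝ × ℝ) :=
  {p | ∃ lc ls : Fin 8 → ℝ,
    lc ∈ stdSimplex ℝ (Fin 8) ∧ ls ∈ stdSimplex ℝ (Fin 8) ∧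
    (p.2.1, p.2.2.1, p.2.2.2.1) = ∑ k, lc k • xiC l1 u1 l2 u2 l3 u3 k ∧
    (p.2.1, p.2.2.1, p.2.2.2.2) = ∑ k, ls k • xiC l1 u1 l2 u2 l4 u4 k ∧
    p.1 = ac * ∑ k, lc k * tri (xiC l1 u1 l2 u2 l3 u3 k)
        + as * ∑ k, ls k * tri (xiC l1 u1 l2 u2 l4 u4 k) ∧
    Linking l1 u1 l2 u2 lc ls}

/-- `S`: the convex hull of the 16 points `(φ(γ), γ)`, `γ` a vertex of `B`. -/
def Shull (l1 u1 l2 u2 l3 u3 l4 u4 ac as : ℝ) : Set (ℝ × ℝ × ℝ × ℝ × ℝ) :=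
  convexHull ℝ ((fun x => (phi ac as x, x)) '' vertB l1 u1 l2 u2 l3 u3 l4 u4)

/-- A nonnegative combination of the endpoints of an interval is a multiple of one of its points. -/
theorem exists_mem_Icc_weighted_eq {l u a b : ℝ} (h : l ≤ u) (ha : 0 ≤ a) (hb : 0 ≤ b) :
    ∃ y ∈ Set.Icc l u, a * l + b * u = (a + b) * y := by
  rcases (add_nonneg ha hb).eq_or_lt with h0 | h0
  · obtain rfl : a = 0 := by linarith
    obtain rfl : b = 0 := by linarith
    exact ⟨l, ⟨le_rfl, h⟩, by simp⟩
  · refine ⟨(a * l + b * u) / (a + b), ⟨?_, ?_⟩, by field_simp⟩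
    · rw [le_div_iff₀ h0]
      nlinarith
    · rw [div_le_iff₀ h0]
      nlinarith

/-- A signed measure on the vertices of a nondegenerate rectangle is zero as soon as its moments
against `1`, `x`, `y` and `x * y` vanish. -/
theorem eq_zero_of_bilinear_moments {l1 u1 l2 u2 d0 d1 d2 d3 : ℝ} (h1 : l1 < u1) (h2 : l2 < u2)
    (hs : d0 + d1 + d2 + d3 = 0)
    (hx : (d0 + d1) * l1 + (d2 + d3) * u1 = 0)
    (hy : (d0 + d2) * l2 + (d1 + d3) * u2 = 0)
    (hxy : d0 * (l1 * l2) + d1 * (l1 * u2) + d2 * (u1 * l2) + d3 * (u1 * u2) = 0) :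
    d0 = 0 ∧ d1 = 0 ∧ d2 = 0 ∧ d3 = 0 := by
  have hne : (u1 - l1) * (u2 - l2) ≠ 0 := mul_ne_zero (by linarith) (by linarith)
  refine ⟨?_, ?_, ?_, ?_⟩ <;> refine (mul_eq_zero.mp ?_).resolve_left hne
  · linear_combination u1 * u2 * hs - u2 * hx - u1 * hy + hxy
  · linear_combination -u1 * l2 * hs + l2 * hx + u1 * hy - hxy
  · linear_combination -l1 * u2 * hs + u2 * hx + l1 * hy - hxy
  · linear_combination l1 * l2 * hs - l2 * hx - l1 * hy + hxy

/-- The relaxation set is convex. -/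
theorem convex_SQC (l1 u1 l2 u2 l3 u3 l4 u4 ac as : ℝ) :
    Convex ℝ (SQC l1 u1 l2 u2 l3 u3 l4 u4 ac as) := by
  rintro p ⟨lc, ls, hlc, hls, hc, hs, hz, hL⟩ q ⟨mc, ms, hmc, hms, kc, ks, kz, kL⟩ a b ha hb hab
  refine ⟨a • lc + b • mc, a • ls + b • ms, convex_stdSimplex ℝ _ hlc hmc ha hb hab,
    convex_stdSimplex ℝ _ hls hms ha hb hab, ?_, ?_, ?_, ?_⟩
  · simp only [Pi.add_apply, Pi.smul_apply, smul_eq_mul, add_smul, mul_smul, sum_add_distrib,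
      ← smul_sum, ← hc, ← kc]
    rfl
  · simp only [Pi.add_apply, Pi.smul_apply, smul_eq_mul, add_smul, mul_smul, sum_add_distrib,
      ← smul_sum, ← hs, ← ks]
    rfl
  · simp only [Pi.add_apply, Pi.smul_apply, smul_eq_mul, add_mul, mul_assoc, sum_add_distrib,
      ← mul_sum, Prod.fst_add, Prod.smul_fst, hz, kz]
    ring
  · simp only [Linking, Pi.add_apply, Pi.smul_apply, smul_eq_mul] at *
    linear_combination a * hL + b * kL

/-- Every point of an interval is a convex combination of its endpoints. -/
theorem exists_unitInterval_param {l u x : ℝ} (hx : x ∈ Set.Icc l u) :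
    ∃ s t : ℝ, 0 ≤ s ∧ 0 ≤ t ∧ s + t = 1 ∧ s * l + t * u = x := by
  rw [← segment_eq_Icc (hx.1.trans hx.2)] at hx
  obtain ⟨s, t, hs, ht, hst, h⟩ := hx
  exact ⟨s, t, hs, ht, hst, h⟩

/-- The product weights of a point of a three-dimensional box. -/
def prodWeight (s1 t1 s2 t2 s3 t3 : ℝ) : Fin 8 → ℝ :=
  ![s1 * s2 * s3, s1 * s2 * t3, s1 * t2 * s3, s1 * t2 * t3,
    t1 * s2 * s3, t1 * s2 * t3, t1 * t2 * s3, t1 * t2 * t3]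

theorem prodWeight_mem_stdSimplex {s1 t1 s2 t2 s3 t3 : ℝ} (hs1 : 0 ≤ s1) (ht1 : 0 ≤ t1)
    (h1 : s1 + t1 = 1) (hs2 : 0 ≤ s2) (ht2 : 0 ≤ t2) (h2 : s2 + t2 = 1) (hs3 : 0 ≤ s3)
    (ht3 : 0 ≤ t3) (h3 : s3 + t3 = 1) :
    prodWeight s1 t1 s2 t2 s3 t3 ∈ stdSimplex ℝ (Fin 8) := by
  constructor
  · intro k
    fin_cases k <;> simp [prodWeight] <;> positivity
  · obtain rfl : s1 = 1 - t1 := by linarith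
    obtain rfl : s2 = 1 - t2 := by linarith
    obtain rfl : s3 = 1 - t3 := by linarith
    simp [prodWeight, Fin.sum_univ_eight]
    ring

theorem sum_prodWeight_smul_xiC {s1 t1 s2 t2 s3 t3 : ℝ} (l1 u1 l2 u2 l3 u3 : ℝ)
    (h1 : s1 + t1 = 1) (h2 : s2 + t2 = 1) (h3 : s3 + t3 = 1) :
    ∑ k, prodWeight s1 t1 s2 t2 s3 t3 k • xiC l1 u1 l2 u2 l3 u3 k =
      (s1 * l1 + t1 * u1, s2 * l2 + t2 * u2, s3 * l3 + t3 * u3) := by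
  obtain rfl : s1 = 1 - t1 := by linarith
  obtain rfl : s2 = 1 - t2 := by linarith
  obtain rfl : s3 = 1 - t3 := by linarith
  simp only [prodWeight, xiC, Fin.sum_univ_eight, Matrix.cons_val, Prod.smul_mk, Prod.mk_add_mk,
    smul_eq_mul, Prod.mk.injEq]
  refine ⟨?_, ?_, ?_⟩ <;> ring

theorem sum_prodWeight_mul_tri (s1 t1 s2 t2 s3 t3 l1 u1 l2 u2 l3 u3 : ℝ) :
    ∑ k, prodWeight s1 t1 s2 t2 s3 t3 k * tri (xiC l1 u1 l2 u2 l3 u3 k) =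
      (s1 * l1 + t1 * u1) * (s2 * l2 + t2 * u2) * (s3 * l3 + t3 * u3) := by
  simp only [prodWeight, xiC, tri, Fin.sum_univ_eight, Matrix.cons_val]
  ring

/-- The graph of `phi` over the box lies in the relaxation set. -/
theorem phi_graph_mem_SQC {l1 u1 l2 u2 l3 u3 l4 u4 : ℝ} (ac as : ℝ) {x : ℝ × ℝ × ℝ × ℝ}
    (hx : x ∈ boxB l1 u1 l2 u2 l3 u3 l4 u4) :
    (phi ac as x, x) ∈ SQC l1 u1 l2 u2 l3 u3 l4 u4 ac as := by
  obtain ⟨x1, x2, x3, x4⟩ := x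
  obtain ⟨hx1, hx2, hx3, hx4⟩ := hx
  obtain ⟨s1, t1, hs1, ht1, h1, rfl⟩ := exists_unitInterval_param hx1
  obtain ⟨s2, t2, hs2, ht2, h2, rfl⟩ := exists_unitInterval_param hx2
  obtain ⟨s3, t3, hs3, ht3, h3, rfl⟩ := exists_unitInterval_param hx3
  obtain ⟨s4, t4, hs4, ht4, h4, rfl⟩ := exists_unitInterval_param hx4
  refine ⟨prodWeight s1 t1 s2 t2 s3 t3, prodWeight s1 t1 s2 t2 s4 t4,
    prodWeight_mem_stdSimplex hs1 ht1 h1 hs2 ht2 h2 hs3 ht3 h3,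
    prodWeight_mem_stdSimplex hs1 ht1 h1 hs2 ht2 h2 hs4 ht4 h4,
    (sum_prodWeight_smul_xiC _ _ _ _ _ _ h1 h2 h3).symm,
    (sum_prodWeight_smul_xiC _ _ _ _ _ _ h1 h2 h4).symm, ?_, ?_⟩
  · rw [sum_prodWeight_mul_tri, sum_prodWeight_mul_tri]
    rfl
  · obtain rfl : s3 = 1 - t3 := by linarith
    obtain rfl : s4 = 1 - t4 := by linarith
    simp only [Linking, prodWeight, Matrix.cons_val]
    ring

/-- Every point of the relaxation set is a convex combination of points of the graph of `phi`. -/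
theorem SQC_subset_convexHull_phi_graph {l1 u1 l2 u2 l3 u3 l4 u4 : ℝ} (ac as : ℝ)
    (h1 : l1 < u1) (h2 : l2 < u2) (h3 : l3 ≤ u3) (h4 : l4 ≤ u4) :
    SQC l1 u1 l2 u2 l3 u3 l4 u4 ac as ⊆
      convexHull ℝ ((fun x => (phi ac as x, x)) '' boxB l1 u1 l2 u2 l3 u3 l4 u4) := by
  rintro ⟨z, x1, x2, x3, x4⟩ ⟨lc, ls, ⟨hlc, hlc'⟩, ⟨hls, hls'⟩, hc, hs, hz, hL⟩
  simp only [xiC, tri, Linking, Fin.sum_univ_eight, Matrix.cons_val, Prod.smul_mk, Prod.mk_add_mk,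
    smul_eq_mul, Prod.mk.injEq] at hlc' hls' hc hs hz hL
  obtain ⟨hc1, hc2, hc3⟩ := hc
  obtain ⟨hs1, hs2, hs3⟩ := hs
  obtain ⟨e0, e1, e2, e3⟩ := eq_zero_of_bilinear_moments
    (d0 := lc 0 + lc 1 - ls 0 - ls 1) (d1 := lc 2 + lc 3 - ls 2 - ls 3)
    (d2 := lc 4 + lc 5 - ls 4 - ls 5) (d3 := lc 6 + lc 7 - ls 6 - ls 7) h1 h2
    (by linear_combination hlc' - hls') (by linear_combination hs1 - hc1)
    (by linear_combination hs2 - hc2) hL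
  obtain ⟨y0, hy0, k0⟩ := exists_mem_Icc_weighted_eq h3 (hlc 0) (hlc 1)
  obtain ⟨y1, hy1, k1⟩ := exists_mem_Icc_weighted_eq h3 (hlc 2) (hlc 3)
  obtain ⟨y2, hy2, k2⟩ := exists_mem_Icc_weighted_eq h3 (hlc 4) (hlc 5)
  obtain ⟨y3, hy3, k3⟩ := exists_mem_Icc_weighted_eq h3 (hlc 6) (hlc 7)
  obtain ⟨v0, hv0, m0⟩ := exists_mem_Icc_weighted_eq h4 (hls 0) (hls 1)
  obtain ⟨v1, hv1, m1⟩ := exists_mem_Icc_weighted_eq h4 (hls 2) (hls 3)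
  obtain ⟨v2, hv2, m2⟩ := exists_mem_Icc_weighted_eq h4 (hls 4) (hls 5)
  obtain ⟨v3, hv3, m3⟩ := exists_mem_Icc_weighted_eq h4 (hls 6) (hls 7)
  have hl1 : l1 ∈ Set.Icc l1 u1 := ⟨le_rfl, h1.le⟩
  have hu1 : u1 ∈ Set.Icc l1 u1 := ⟨h1.le, le_rfl⟩
  have hl2 : l2 ∈ Set.Icc l2 u2 := ⟨le_rfl, h2.le⟩
  have hu2 : u2 ∈ Set.Icc l2 u2 := ⟨h2.le, le_rfl⟩
  let w : Fin 4 → ℝ := ![lc 0 + lc 1, lc 2 + lc 3, lc 4 + lc 5, lc 6 + lc 7]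
  let P : Fin 4 → ℝ × ℝ × ℝ × ℝ :=
    ![(l1, l2, y0, v0), (l1, u2, y1, v1), (u1, l2, y2, v2), (u1, u2, y3, v3)]
  have hP : ∀ i, P i ∈ boxB l1 u1 l2 u2 l3 u3 l4 u4 := by
    intro i
    fin_cases i
    exacts [⟨hl1, hl2, hy0, hv0⟩, ⟨hl1, hu2, hy1, hv1⟩, ⟨hu1, hl2, hy2, hv2⟩, ⟨hu1, hu2, hy3, hv3⟩]
  have hw : ∀ i ∈ univ, 0 ≤ w i := by
    intro i _
    fin_cases i
    exacts [add_nonneg (hlc 0) (hlc 1), add_nonneg (hlc 2) (hlc 3), add_nonneg (hlc 4) (hlc 5),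
      add_nonneg (hlc 6) (hlc 7)]
  have hw1 : ∑ i, w i = 1 := by
    simp only [w, Fin.sum_univ_four, Matrix.cons_val]
    linear_combination hlc'
  have key := (convex_convexHull ℝ _).sum_mem hw hw1 fun i _ =>
    subset_convexHull ℝ _ (Set.mem_image_of_mem (fun x => (phi ac as x, x)) (hP i))
  convert key using 1
  simp only [w, P, phi, Fin.sum_univ_four, Matrix.cons_val, Prod.smul_mk, Prod.mk_add_mk,
    smul_eq_mul, Prod.mk.injEq]
  refine ⟨?_, ?_, ?_, ?_, ?_⟩
  · linear_combination hz
      + ac * (l1 * l2 * k0 + l1 * u2 * k1 + u1 * l2 * k2 + u1 * u2 * k3)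
      + as * (l1 * l2 * (m0 - v0 * e0) + l1 * u2 * (m1 - v1 * e1)
        + u1 * l2 * (m2 - v2 * e2) + u1 * u2 * (m3 - v3 * e3))
  · linear_combination hc1
  · linear_combination hc2
  · linear_combination hc3 + k0 + k1 + k2 + k3
  · linear_combination hs3 + m0 + m1 + m2 + m3 - v0 * e0 - v1 * e1 - v2 * e2 - v3 * e3

/-- Theorem 1: with `α_c = -g`, `α_s = -b`, the strengthened (TLM)
relaxation set equals the convex hull of the graph of the non-convex active-power
term `-g x₁x₂x₃ - b x₁x₂x₄` over the box `B`. -/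
theorem SQC_eq_convexHull_active_power (l1 u1 l2 u2 l3 u3 l4 u4 g b : ℝ)
    (h1 : l1 < u1) (h2 : l2 < u2) (h3 : l3 ≤ u3) (h4 : l4 ≤ u4) :
    SQC l1 u1 l2 u2 l3 u3 l4 u4 (-g) (-b) =
      convexHull ℝ
        ((fun x : ℝ × ℝ × ℝ × ℝ =>
            (-g * (x.1 * x.2.1 * x.2.2.1) - b * (x.1 * x.2.1 * x.2.2.2), x)) ''
          boxB l1 u1 l2 u2 l3 u3 l4 u4) := by
  have hphi : (fun x : ℝ × ℝ × ℝ × ℝ =>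
      (-g * (x.1 * x.2.1 * x.2.2.1) - b * (x.1 * x.2.1 * x.2.2.2), x)) =
      fun x => (phi (-g) (-b) x, x) := by
    funext x
    simp only [phi, Prod.mk.injEq, and_true]
    ring
  rw [hphi]
  refine (SQC_subset_convexHull_phi_graph _ _ h1 h2 h3 h4).antisymm
    (convexHull_min ?_ (convex_SQC _ _ _ _ _ _ _ _ _ _))
  rintro _ ⟨x, hx, rfl⟩
  exact phi_graph_mem_SQC _ _ hx
end
end

section
/- (Backward inclusion in the proof of Theorems 1 and 2) Suppose l₁ < u₁ and l₂ < u₂. Then every point of S_QC lies in S; that is, if (z, x₁, x₂, x₃, x₄) admits λᶜ, λˢ ∈ Δ₈ realizing the extreme-point representation and satisfying the linking constraint, then (z, x₁, x₂, x₃, x₄) lies in the convex hull of the 16 points {(φ(γ), γ) : γ a vertex of B}. Hence S_QC ⊆ S. -/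
open Finset Real

noncomputable section

/-- Two nonnegative measures on a two-point set with equal total mass admit a coupling. -/
theorem exists_coupling_two {p₀ p₁ q₀ q₁ : ℝ} (hp₀ : 0 ≤ p₀) (hp₁ : 0 ≤ p₁) (hq₀ : 0 ≤ q₀)
    (hq₁ : 0 ≤ q₁) (h : p₀ + p₁ = q₀ + q₁) :
    ∃ w : Fin 2 → Fin 2 → ℝ, (∀ i j, 0 ≤ w i j) ∧ p₀ = w 0 0 + w 0 1 ∧ p₁ = w 1 0 + w 1 1 ∧
      q₀ = w 0 0 + w 1 0 ∧ q₁ = w 0 1 + w 1 1 := by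
  rcases le_total p₀ q₀ with hle | hle
  · refine ⟨![![p₀, 0], ![q₀ - p₀, q₁]], ?_, ?_⟩
    · simp [Fin.forall_fin_two, *]
    · simp; linarith
  · refine ⟨![![q₀, p₀ - q₀], ![0, p₁]], ?_, ?_⟩
    · simp [Fin.forall_fin_two, *]
    · simp; linarith

/-- A signed measure on the vertices of a nondegenerate rectangle is zero as soon as its integrals
against `1`, `x`, `y` and `x * y` vanish. -/
theorem eq_zero_of_bilinear_moments_s4 {l₁ u₁ l₂ u₂ a b c d : ℝ} (h₁ : l₁ < u₁) (h₂ : l₂ < u₂)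
    (hs : a + b + c + d = 0) (hx : (a + b) * l₁ + (c + d) * u₁ = 0)
    (hy : (a + c) * l₂ + (b + d) * u₂ = 0)
    (hxy : a * (l₁ * l₂) + b * (l₁ * u₂) + c * (u₁ * l₂) + d * (u₁ * u₂) = 0) :
    a = 0 ∧ b = 0 ∧ c = 0 ∧ d = 0 := by
  have hcd : c + d = 0 := by
    refine (mul_eq_zero.mp ?_).resolve_right (sub_pos.mpr h₁).ne'
    linear_combination hx - l₁ * hs
  have hbd : b + d = 0 := by
    refine (mul_eq_zero.mp ?_).resolve_right (sub_pos.mpr h₂).ne'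
    linear_combination hy - l₂ * hs
  have hd : d = 0 := by
    refine (mul_eq_zero.mp ?_).resolve_right
      (mul_pos (sub_pos.mpr h₁) (sub_pos.mpr h₂)).ne'
    linear_combination hxy - l₁ * hy - l₂ * hx + l₁ * l₂ * hs
  refine ⟨?_, ?_, ?_, hd⟩ <;> linarith

/-- backward inclusion: if `l₁ < u₁` and `l₂ < u₂`, then `S_QC ⊆ S`. -/
theorem SQC_subset_Shull (l1 u1 l2 u2 l3 u3 l4 u4 ac as : ℝ)
    (h1 : l1 < u1) (h2 : l2 < u2) (h3 : l3 ≤ u3) (h4 : l4 ≤ u4) :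
    SQC l1 u1 l2 u2 l3 u3 l4 u4 ac as ⊆ Shull l1 u1 l2 u2 l3 u3 l4 u4 ac as := by
  rintro ⟨z, x₁, x₂, x₃, x₄⟩ ⟨lc, ls, ⟨hc, hc1⟩, ⟨hs, hs1⟩, hxc, hxs, hz, hL⟩
  simp only [Fin.sum_univ_eight, xiC, Matrix.cons_val, Prod.smul_mk, Prod.mk_add_mk, smul_eq_mul,
    Prod.mk.injEq, tri, Linking] at hc1 hs1 hxc hxs hz hL
  obtain ⟨hxc1, hxc2, hxc3⟩ := hxc
  obtain ⟨hxs1, hxs2, hxs4⟩ := hxs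
  obtain ⟨e₀₀, e₀₁, e₁₀, e₁₁⟩ := eq_zero_of_bilinear_moments_s4 h1 h2
    (by linear_combination hc1 - hs1) (by linear_combination hxs1 - hxc1)
    (by linear_combination hxs2 - hxc2) hL
  obtain ⟨w₀₀, n₀₀, c0, c1, s0, s1⟩ :=
    exists_coupling_two (hc 0) (hc 1) (hs 0) (hs 1) (by linarith)
  obtain ⟨w₀₁, n₀₁, c2, c3, s2, s3⟩ :=
    exists_coupling_two (hc 2) (hc 3) (hs 2) (hs 3) (by linarith)
  obtain ⟨w₁₀, n₁₀, c4, c5, s4, s5⟩ :=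
    exists_coupling_two (hc 4) (hc 5) (hs 4) (hs 5) (by linarith)
  obtain ⟨w₁₁, n₁₁, c6, c7, s6, s7⟩ :=
    exists_coupling_two (hc 6) (hc 7) (hs 6) (hs 7) (by linarith)
  rw [c0, c1, c2, c3, c4, c5, c6, c7] at hc1 hxc1 hxc2 hxc3 hz
  rw [s0, s1, s2, s3, s4, s5, s6, s7] at hxs4 hz
  let w : Fin 2 × Fin 2 × Fin 2 × Fin 2 → ℝ := fun t =>
    ![![w₀₀, w₀₁], ![w₁₀, w₁₁]] t.1 t.2.1 t.2.2.1 t.2.2.2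
  let γ : Fin 2 × Fin 2 × Fin 2 × Fin 2 → ℝ × ℝ × ℝ × ℝ := fun t =>
    (![l1, u1] t.1, ![l2, u2] t.2.1, ![l3, u3] t.2.2.1, ![l4, u4] t.2.2.2)
  have hw : ∀ t ∈ (univ : Finset _), 0 ≤ w t := by
    rintro ⟨i, j, k, m⟩ -
    revert i j
    simp [w, Fin.forall_fin_two, n₀₀, n₀₁, n₁₀, n₁₁]
  have hw1 : ∑ t, w t = 1 := by
    simp only [Fintype.sum_prod_type, Fin.sum_univ_two, w, Matrix.cons_val]
    linear_combination hc1
  have hγ : ∀ t ∈ (univ : Finset _), (phi ac as (γ t), γ t) ∈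
      Shull l1 u1 l2 u2 l3 u3 l4 u4 ac as := by
    rintro ⟨i, j, k, m⟩ -
    refine subset_convexHull ℝ _ ⟨_, ⟨?_, ?_, ?_, ?_⟩, rfl⟩
    · fin_cases i <;> simp [γ]
    · fin_cases j <;> simp [γ]
    · fin_cases k <;> simp [γ]
    · fin_cases m <;> simp [γ]
  have hmem := (convex_convexHull ℝ _ : Convex ℝ (Shull l1 u1 l2 u2 l3 u3 l4 u4 ac as)).sum_mem
    hw hw1 hγ
  suffices h : (z, x₁, x₂, x₃, x₄) = ∑ t, w t • (phi ac as (γ t), γ t) from h ▸ hmem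
  simp only [Prod.ext_iff, Prod.fst_sum, Prod.snd_sum, Prod.smul_fst, Prod.smul_snd, smul_eq_mul]
  simp only [Fintype.sum_prod_type, Fin.sum_univ_two, w, γ, phi, Matrix.cons_val]
  refine ⟨?_, ?_, ?_, ?_, ?_⟩
  · linear_combination hz
  · linear_combination hxc1
  · linear_combination hxc2
  · linear_combination hxc3
  · linear_combination hxs4
end
end

section
/- (Validity of the lower tangent bound on sine in S-CONV) For every real m with 0 < m ≤ π/2 and every real x with |x| ≤ m, one has sin x ≥ cos(m/2)·(x + m/2) − sin(m/2). -/
open Real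

/-- Huygens' inequality `2 sin a + tan a ≥ 3 a`. -/
theorem three_mul_le_two_mul_sin_add_tan {a : ℝ} (h0 : 0 ≤ a) (h1 : a < π / 2) :
    3 * a ≤ 2 * sin a + tan a := by
  have hcos : ∀ y ∈ Set.Ico (0 : ℝ) (π / 2), 0 < cos y := fun y hy =>
    cos_pos_of_mem_Ioo ⟨by linarith [hy.1, pi_pos], hy.2⟩
  have hderiv : ∀ y ∈ Set.Ico (0 : ℝ) (π / 2),
      HasDerivAt (fun y => 2 * sin y + tan y - 3 * y) (2 * cos y + 1 / cos y ^ 2 - 3 * 1) y :=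
    fun y hy => (((hasDerivAt_sin y).const_mul 2).add (hasDerivAt_tan (hcos y hy).ne')).sub
      ((hasDerivAt_id y).const_mul 3)
  have hmono : MonotoneOn (fun y => 2 * sin y + tan y - 3 * y) (Set.Ico (0 : ℝ) (π / 2)) := by
    refine monotoneOn_of_hasDerivWithinAt_nonneg (convex_Ico _ _)
      (fun y hy => (hderiv y hy).continuousAt.continuousWithinAt)
      (fun y hy => (hderiv y (interior_subset hy)).hasDerivWithinAt) fun y hy => ?_
    have hc := hcos y (interior_subset hy)
    have key : 2 * cos y + 1 / cos y ^ 2 - 3 * 1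
        = (cos y - 1) ^ 2 * (2 * cos y + 1) / cos y ^ 2 := by
      field_simp
      ring
    rw [key]
    positivity
  have h := hmono ⟨le_rfl, by positivity⟩ ⟨h0, h1⟩ h0
  simp only [sin_zero, tan_zero] at h
  linarith

theorem mul_cos_le_sin {u : ℝ} (h0 : 0 ≤ u) (h1 : u < π / 2) : u * cos u ≤ sin u := by
  have hc : 0 < cos u := cos_pos_of_mem_Ioo ⟨by linarith [pi_pos], h1⟩
  have h := le_tan h0 h1
  rwa [tan_eq_sin_div_cos, le_div_iff₀ hc] at h

/-- The graph of sine on `[0, ∞)` lies below its tangent at a point `a ∈ [0, π / 2)`. -/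
theorem sin_le_sin_add_cos_mul_sub {a y : ℝ} (ha0 : 0 ≤ a) (ha : a < π / 2) (hy : 0 ≤ y) :
    sin y ≤ sin a + cos a * (y - a) := by
  have hca : 0 < cos a := cos_pos_of_mem_Ioo ⟨by linarith [pi_pos], ha⟩
  have hsa : 0 ≤ sin a := sin_nonneg_of_nonneg_of_le_pi ha0 (by linarith [pi_pos])
  rcases le_total a y with h | h
  · have e : sin y = sin a * cos (y - a) + cos a * sin (y - a) := by
      rw [← sin_add]
      ring_nf
    have h1 := mul_le_mul_of_nonneg_left (cos_le_one (y - a)) hsa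
    have h2 := mul_le_mul_of_nonneg_left (sin_le (sub_nonneg.2 h)) hca.le
    linarith
  · obtain ⟨u, rfl⟩ : ∃ u, y = a - u := ⟨a - y, by ring⟩
    have hu : 0 ≤ u := by linarith
    have hcu : 0 < cos u := cos_pos_of_mem_Ioo ⟨by linarith [pi_pos], by linarith⟩
    have h1 : u * cos u ≤ sin u := mul_cos_le_sin hu (by linarith)
    have h2 : 0 ≤ sin a * cos u - cos a * sin u := by
      rw [← sin_sub]
      exact sin_nonneg_of_nonneg_of_le_pi hy (by linarith [pi_pos])
    have h3 := mul_nonneg h2 (sub_nonneg.2 (cos_le_one u))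
    have h4 := mul_nonneg hca.le (sub_nonneg.2 h1)
    have h5 : 0 ≤ (sin a * (1 - cos u) - cos a * (u - sin u)) * cos u := by linarith
    have h6 := nonneg_of_mul_nonneg_left h5 hcu
    rw [sin_sub]
    linarith

/-- lower tangent bound on sine in S-CONV: for `0 < m ≤ π/2` and
`|x| ≤ m`, `sin x ≥ cos(m/2)·(x + m/2) - sin(m/2)`. -/
theorem sin_ge_lower_tangent (m x : ℝ)
    (hm0 : 0 < m) (hm : m ≤ π / 2) (hx : |x| ≤ m) :
    sin x ≥ cos (m / 2) * (x + m / 2) - sin (m / 2) := by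
  have hm2 : m / 2 < π / 2 := by linarith
  rcases le_total x 0 with h | h
  · have := sin_le_sin_add_cos_mul_sub (a := m / 2) (y := -x) (by linarith) hm2 (by linarith)
    rw [sin_neg] at this
    linarith
  · have hxm : x ≤ m := (le_abs_self x).trans hx
    have hc : 0 < cos (m / 2) := cos_pos_of_mem_Ioo ⟨by linarith, hm2⟩
    have hleft : m / 2 * cos (m / 2) ≤ sin (m / 2) := mul_cos_le_sin (by linarith) hm2
    have hright : 3 * (m / 2) * cos (m / 2) ≤ sin m + sin (m / 2) := by
      have h1 := mul_le_mul_of_nonneg_right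
        (three_mul_le_two_mul_sin_add_tan (a := m / 2) (by linarith) hm2) hc.le
      rw [add_mul, tan_mul_cos hc.ne'] at h1
      have h2 : sin m = 2 * sin (m / 2) * cos (m / 2) := by
        rw [← sin_two_mul]
        ring_nf
      linarith
    have hchord : x * sin m ≤ m * sin x := by
      have h1 := strictConcaveOn_sin_Icc.concaveOn.2
        (Set.left_mem_Icc.2 pi_pos.le) (⟨hm0.le, by linarith⟩ : m ∈ Set.Icc 0 π)
        (sub_nonneg.2 ((div_le_one hm0).2 hxm)) (div_nonneg h hm0.le) (sub_add_cancel _ _)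
      simp only [smul_eq_mul, sin_zero, mul_zero, zero_add, div_mul_cancel₀ x hm0.ne'] at h1
      rwa [div_mul_eq_mul_div, div_le_iff₀' hm0] at h1
    have h1 := mul_nonneg h (sub_nonneg.2 hright)
    have h2 := mul_nonneg (sub_nonneg.2 hxm) (sub_nonneg.2 hleft)
    refine le_of_mul_le_mul_left ?_ hm0
    linarith
end

section
/- (TLM dominates the recursive McCormick relaxation) Suppose l₁ < u₁ and l₂ < u₂. Then S_QC ⊆ R_RM, i.e. every point of the strengthened (TLM) relaxation set satisfies the recursive McCormick (RM) relaxation of z = α_c x₁x₂x₃ + α_s x₁x₂x₄. -/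
open Finset Real

noncomputable section

/-- The McCormick set `M(aˡ, aᵘ, bˡ, bᵘ)` of triples `(a, b, w)`. -/
def McCormick (al au bl bu : ℝ) : Set (ℝ × ℝ × ℝ) :=
  {t | t.2.2 ≥ al * t.2.1 + bl * t.1 - al * bl ∧
       t.2.2 ≥ au * t.2.1 + bu * t.1 - au * bu ∧
       t.2.2 ≤ al * t.2.1 + bu * t.1 - al * bu ∧
       t.2.2 ≤ au * t.2.1 + bl * t.1 - au * bl}

/-- Lower bound `wˡ = min{l₁l₂, l₁u₂, u₁l₂, u₁u₂}` on the voltage product. -/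
def wLo (l1 u1 l2 u2 : ℝ) : ℝ := min (min (l1 * l2) (l1 * u2)) (min (u1 * l2) (u1 * u2))

/-- Upper bound `wᵘ = max{l₁l₂, l₁u₂, u₁l₂, u₁u₂}` on the voltage product. -/
def wHi (l1 u1 l2 u2 : ℝ) : ℝ := max (max (l1 * l2) (l1 * u2)) (max (u1 * l2) (u1 * u2))

/-- The recursive McCormick (RM) relaxation set `R_RM ⊆ ℝ⁵`. -/
def RRM (l1 u1 l2 u2 l3 u3 l4 u4 ac as : ℝ) : Set (ℝ × ℝ × ℝ × ℝ × ℝ) :=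
  {p | (p.2.1, p.2.2.1, p.2.2.2.1, p.2.2.2.2) ∈ boxB l1 u1 l2 u2 l3 u3 l4 u4 ∧
    ∃ w zc zs : ℝ,
      w ∈ Set.Icc (wLo l1 u1 l2 u2) (wHi l1 u1 l2 u2) ∧
      (p.2.1, p.2.2.1, w) ∈ McCormick l1 u1 l2 u2 ∧
      (w, p.2.2.2.1, zc) ∈ McCormick (wLo l1 u1 l2 u2) (wHi l1 u1 l2 u2) l3 u3 ∧
      (w, p.2.2.2.2, zs) ∈ McCormick (wLo l1 u1 l2 u2) (wHi l1 u1 l2 u2) l4 u4 ∧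
      p.1 = ac * zc + as * zs}

theorem sum_mul_mem_Icc {ι : Type*} [Fintype ι] {c a : ι → ℝ} {l u : ℝ}
    (hc : c ∈ stdSimplex ℝ ι) (ha : ∀ i, a i ∈ Set.Icc l u) :
    ∑ i, c i * a i ∈ Set.Icc l u :=
  (convex_Icc l u).sum_mem (fun i _ => hc.1 i) hc.2 (fun i _ => ha i)

theorem mul_mem_McCormick {al au bl bu a b : ℝ}
    (ha : a ∈ Set.Icc al au) (hb : b ∈ Set.Icc bl bu) :
    (a, b, a * b) ∈ McCormick al au bl bu := by
  obtain ⟨ha, ha'⟩ := ha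
  obtain ⟨hb, hb'⟩ := hb
  refine ⟨?_, ?_, ?_, ?_⟩ <;> dsimp only <;> nlinarith

theorem convex_McCormick (al au bl bu : ℝ) : Convex ℝ (McCormick al au bl bu) := by
  rintro x ⟨hx1, hx2, hx3, hx4⟩ y ⟨hy1, hy2, hy3, hy4⟩ s t hs ht hst
  obtain rfl : t = 1 - s := by linarith
  refine ⟨?_, ?_, ?_, ?_⟩ <;>
    simp only [Prod.fst_add, Prod.snd_add, Prod.smul_fst, Prod.smul_snd, smul_eq_mul]
  · nlinarith [mul_le_mul_of_nonneg_left hx1 hs, mul_le_mul_of_nonneg_left hy1 ht]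
  · nlinarith [mul_le_mul_of_nonneg_left hx2 hs, mul_le_mul_of_nonneg_left hy2 ht]
  · nlinarith [mul_le_mul_of_nonneg_left hx3 hs, mul_le_mul_of_nonneg_left hy3 ht]
  · nlinarith [mul_le_mul_of_nonneg_left hx4 hs, mul_le_mul_of_nonneg_left hy4 ht]

/-- Averages of pointwise products satisfy the McCormick inequalities. -/
theorem sum_mul_mem_McCormick {ι : Type*} [Fintype ι] {c a b : ι → ℝ} {al au bl bu : ℝ}
    (hc : c ∈ stdSimplex ℝ ι) (ha : ∀ i, a i ∈ Set.Icc al au) (hb : ∀ i, b i ∈ Set.Icc bl bu) :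
    (∑ i, c i * a i, ∑ i, c i * b i, ∑ i, c i * (a i * b i)) ∈ McCormick al au bl bu := by
  have h := (convex_McCormick al au bl bu).sum_mem (t := Finset.univ) (fun i _ => hc.1 i) hc.2
    (fun i _ => mul_mem_McCormick (ha i) (hb i))
  convert h using 1
  ext <;> simp [Prod.fst_sum, Prod.snd_sum]

theorem xiC_mem {l1 u1 l2 u2 l3 u3 : ℝ} (h1 : l1 ≤ u1) (h2 : l2 ≤ u2) (h3 : l3 ≤ u3)
    (k : Fin 8) :
    (xiC l1 u1 l2 u2 l3 u3 k).1 ∈ Set.Icc l1 u1 ∧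
    (xiC l1 u1 l2 u2 l3 u3 k).2.1 ∈ Set.Icc l2 u2 ∧
    (xiC l1 u1 l2 u2 l3 u3 k).2.2 ∈ Set.Icc l3 u3 := by
  fin_cases k <;> simp [xiC, h1, h2, h3]

theorem xiC_mul_mem (l1 u1 l2 u2 l3 u3 : ℝ) (k : Fin 8) :
    (xiC l1 u1 l2 u2 l3 u3 k).1 * (xiC l1 u1 l2 u2 l3 u3 k).2.1 ∈
      Set.Icc (wLo l1 u1 l2 u2) (wHi l1 u1 l2 u2) := by
  fin_cases k <;> simp [xiC, wLo, wHi]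

/-- A convex combination of box vertices, together with the combination of their products,
satisfies the recursive McCormick inequalities for a single trilinear term. -/
theorem sum_xiC_mem_McCormick {l1 u1 l2 u2 l3 u3 x1 x2 x3 : ℝ} {c : Fin 8 → ℝ}
    (h1 : l1 ≤ u1) (h2 : l2 ≤ u2) (h3 : l3 ≤ u3) (hc : c ∈ stdSimplex ℝ (Fin 8))
    (hx : (x1, x2, x3) = ∑ k, c k • xiC l1 u1 l2 u2 l3 u3 k) :
    (x1 ∈ Set.Icc l1 u1 ∧ x2 ∈ Set.Icc l2 u2 ∧ x3 ∈ Set.Icc l3 u3) ∧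
    ∑ k, c k * ((xiC l1 u1 l2 u2 l3 u3 k).1 * (xiC l1 u1 l2 u2 l3 u3 k).2.1) ∈
      Set.Icc (wLo l1 u1 l2 u2) (wHi l1 u1 l2 u2) ∧
    (x1, x2, ∑ k, c k * ((xiC l1 u1 l2 u2 l3 u3 k).1 * (xiC l1 u1 l2 u2 l3 u3 k).2.1)) ∈
      McCormick l1 u1 l2 u2 ∧
    (∑ k, c k * ((xiC l1 u1 l2 u2 l3 u3 k).1 * (xiC l1 u1 l2 u2 l3 u3 k).2.1), x3,
      ∑ k, c k * tri (xiC l1 u1 l2 u2 l3 u3 k)) ∈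
      McCormick (wLo l1 u1 l2 u2) (wHi l1 u1 l2 u2) l3 u3 := by
  have hv := xiC_mem h1 h2 h3
  simp only [Prod.ext_iff, Prod.fst_sum, Prod.snd_sum, Prod.smul_fst, Prod.smul_snd,
    smul_eq_mul] at hx
  obtain ⟨rfl, rfl, rfl⟩ := hx
  exact ⟨⟨sum_mul_mem_Icc hc fun k => (hv k).1, sum_mul_mem_Icc hc fun k => (hv k).2.1,
      sum_mul_mem_Icc hc fun k => (hv k).2.2⟩,
    sum_mul_mem_Icc hc (xiC_mul_mem l1 u1 l2 u2 l3 u3),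
    sum_mul_mem_McCormick hc (fun k => (hv k).1) fun k => (hv k).2.1,
    sum_mul_mem_McCormick hc (xiC_mul_mem l1 u1 l2 u2 l3 u3) fun k => (hv k).2.2⟩

/-- The linking constraint says that both multipliers give the same value of the product
of the first two coordinates. -/
theorem Linking.sum_eq {l1 u1 l2 u2 : ℝ} {lc ls : Fin 8 → ℝ} (h : Linking l1 u1 l2 u2 lc ls)
    (l3 u3 l4 u4 : ℝ) :
    ∑ k, ls k * ((xiC l1 u1 l2 u2 l4 u4 k).1 * (xiC l1 u1 l2 u2 l4 u4 k).2.1) =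
      ∑ k, lc k * ((xiC l1 u1 l2 u2 l3 u3 k).1 * (xiC l1 u1 l2 u2 l3 u3 k).2.1) := by
  unfold Linking at h
  simp [Fin.sum_univ_eight, xiC]
  linarith

/-- TLM dominates RM: if `l₁ < u₁` and `l₂ < u₂`, then `S_QC ⊆ R_RM`. -/
theorem SQC_subset_RRM (l1 u1 l2 u2 l3 u3 l4 u4 ac as : ℝ)
    (h1 : l1 < u1) (h2 : l2 < u2) (h3 : l3 ≤ u3) (h4 : l4 ≤ u4) :
    SQC l1 u1 l2 u2 l3 u3 l4 u4 ac as ⊆ RRM l1 u1 l2 u2 l3 u3 l4 u4 ac as := by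
  rintro ⟨z, x1, x2, x3, x4⟩ ⟨lc, ls, hlc, hls, hxc, hxs, hz, hlink⟩
  obtain ⟨⟨hx1, hx2, hx3⟩, hw, hw', hzc⟩ := sum_xiC_mem_McCormick h1.le h2.le h3 hlc hxc
  obtain ⟨⟨-, -, hx4⟩, -, -, hzs⟩ := sum_xiC_mem_McCormick h1.le h2.le h4 hls hxs
  rw [hlink.sum_eq l3 u3] at hzs
  exact ⟨⟨hx1, hx2, hx3, hx4⟩, _, _, _, hw, hw', hzc, hzs, hz⟩
end
end
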